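/- Suppose u is analytic on the unit disc, a multiplier of the Dirichlet space, bounded away from zero, and φ is a disc automorphism. Then for all n ≥ 1, ‖M_{u_{(n)}}‖_{D→D} ≤ [√2·‖M_{u'}‖_{D→A²}·‖1/u‖_∞ + 2] · n · (1 + n·ρ(φ^{-1}(0),0))^{1/2} · ‖u_{(n)}‖_∞. -/

import Mathlib

open Complex Metric Set Filter MeasureTheory Finset

noncomputable section

/-- The open unit disc in ℂ. -/
def D1 : Set ℂ := Metric.ball 0 1

/-- Analytic (holomorphic) on the open unit disc. -/
def AnalyticOnD (f : ℂ → ℂ) : Prop := DifferentiableOn ℂ f D1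

/-- Bloch seminorm. -/
def blochSemi (f : ℂ → ℂ) : ℝ := ⨆ z : D1, (1 - ‖(z : ℂ)‖ ^ 2) * ‖deriv f (z : ℂ)‖

/-- Bloch norm. -/
def blochNorm (f : ℂ → ℂ) : ℝ := ‖f 0‖ + blochSemi f

/-- Membership in the Bloch space. -/
def InBloch (f : ℂ → ℂ) : Prop :=
  AnalyticOnD f ∧ ∃ C, ∀ z ∈ D1, (1 - ‖z‖ ^ 2) * ‖deriv f z‖ ≤ C

/-- Sup norm over the unit disc. -/
def supNormD (f : ℂ → ℂ) : ℝ := ⨆ z : D1, ‖f (z : ℂ)‖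

/-- Weighted composition operator uC_φ. -/
def wco (u φ : ℂ → ℂ) (f : ℂ → ℂ) : ℂ → ℂ := fun z => u z * f (φ z)

/-- Multiplication operator M_u. -/
def mult (u : ℂ → ℂ) (f : ℂ → ℂ) : ℂ → ℂ := fun z => u z * f z

/-- The weight u_{(n)} = ∏_{j=0}^{n-1} u ∘ φ_j. -/
def wprod (u φ : ℂ → ℂ) (n : ℕ) : ℂ → ℂ := fun z => ∏ j ∈ Finset.range n, u (φ^[j] z)

/-- Boundedness of an operator on the Bloch space. -/
def BddOnBloch (T : (ℂ → ℂ) → (ℂ → ℂ)) : Prop :=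
  ∃ C, ∀ f, InBloch f → InBloch (T f) ∧ blochNorm (T f) ≤ C * blochNorm f

/-- Operator norm on the Bloch space. -/
def opNormB (T : (ℂ → ℂ) → (ℂ → ℂ)) : ℝ :=
  sInf {C : ℝ | 0 ≤ C ∧ ∀ f, InBloch f → blochNorm (T f) ≤ C * blochNorm f}

/-- Invertibility of an operator on the Bloch space (bounded two-sided inverse). -/
def InvertibleOnBloch (T : (ℂ → ℂ) → (ℂ → ℂ)) : Prop :=
  BddOnBloch T ∧ ∃ S, BddOnBloch S ∧
    ∀ f, InBloch f → Set.EqOn (S (T f)) f D1 ∧ Set.EqOn (T (S f)) f D1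

/-- Spectrum of an operator acting on the Bloch space. -/
def blochSpectrum (T : (ℂ → ℂ) → (ℂ → ℂ)) : Set ℂ :=
  {lam | ¬ InvertibleOnBloch (fun f z => lam * f z - T f z)}

/-- Automorphism of the unit disc (Möbius form). -/
def IsDiscAuto (φ : ℂ → ℂ) : Prop :=
  ∃ lam a : ℂ, ‖lam‖ = 1 ∧ a ∈ D1 ∧ ∀ z, φ z = lam * (a - z) / (1 - (starRingEnd ℂ) a * z)

/-- Hyperbolic distance on the unit disc. -/
def hypDist (z w : ℂ) : ℝ :=
  (1 / 2) * Real.log ((1 + ‖(z - w) / (1 - (starRingEnd ℂ) z * w)‖) /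
    (1 - ‖(z - w) / (1 - (starRingEnd ℂ) z * w)‖))

/-- The disc algebra A(𝔻). -/
def InDiscAlgebra (u : ℂ → ℂ) : Prop :=
  ContinuousOn u (Metric.closedBall 0 1) ∧ AnalyticOnD u

/-- u is bounded away from zero on the unit disc. -/
def BoundedAwayFromZero (u : ℂ → ℂ) : Prop := ∃ δ > 0, ∀ z ∈ D1, δ ≤ ‖u z‖

/-- Parabolic automorphism with unique fixed point a on the unit circle (φ'(a)=1). -/
def IsParabolicAuto (φ : ℂ → ℂ) (a : ℂ) : Prop :=
  IsDiscAuto φ ∧ ‖a‖ = 1 ∧ φ a = a ∧ deriv φ a = 1 ∧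
    ∀ w, ‖w‖ ≤ 1 → φ w = w → w = a

/-- Hyperbolic automorphism with attractive fixed point a and repulsive fixed point b. -/
def IsHyperbolicAuto (φ : ℂ → ℂ) (a b : ℂ) : Prop :=
  IsDiscAuto φ ∧ ‖a‖ = 1 ∧ ‖b‖ = 1 ∧ a ≠ b ∧ φ a = a ∧ φ b = b ∧
    ∃ μ : ℝ, 0 < μ ∧ μ < 1 ∧ deriv φ a = (μ : ℂ)

/-- Square of the Dirichlet norm (normalized area measure on 𝔻). -/
def dirichletNormSq (f : ℂ → ℂ) : ℝ :=
  ‖f 0‖ ^ 2 + (1 / Real.pi) * ∫ z in D1, ‖deriv f z‖ ^ 2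

/-- Dirichlet norm. -/
def dirichletNorm (f : ℂ → ℂ) : ℝ := Real.sqrt (dirichletNormSq f)

/-- Membership in the Dirichlet space. -/
def InDirichlet (f : ℂ → ℂ) : Prop :=
  AnalyticOnD f ∧ MeasureTheory.IntegrableOn (fun z => ‖deriv f z‖ ^ 2) D1

/-- Boundedness of an operator on the Dirichlet space. -/
def BddOnDirichlet (T : (ℂ → ℂ) → (ℂ → ℂ)) : Prop :=
  ∃ C, ∀ f, InDirichlet f → InDirichlet (T f) ∧ dirichletNorm (T f) ≤ C * dirichletNorm f

/-- Operator norm on the Dirichlet space. -/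
def opNormDir (T : (ℂ → ℂ) → (ℂ → ℂ)) : ℝ :=
  sInf {C : ℝ | 0 ≤ C ∧ ∀ f, InDirichlet f → dirichletNorm (T f) ≤ C * dirichletNorm f}

/-- Invertibility of an operator on the Dirichlet space. -/
def InvertibleOnDirichlet (T : (ℂ → ℂ) → (ℂ → ℂ)) : Prop :=
  BddOnDirichlet T ∧ ∃ S, BddOnDirichlet S ∧
    ∀ f, InDirichlet f → Set.EqOn (S (T f)) f D1 ∧ Set.EqOn (T (S f)) f D1

/-- Spectrum of an operator on the Dirichlet space. -/
def dirichletSpectrum (T : (ℂ → ℂ) → (ℂ → ℂ)) : Set ℂ :=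
  {lam | ¬ InvertibleOnDirichlet (fun f z => lam * f z - T f z)}

/-- Operator norm of M_{u'} : B → H^∞_{v₁}. -/
def opNormBtoHv1 (u : ℂ → ℂ) : ℝ :=
  sInf {C : ℝ | 0 ≤ C ∧ ∀ f, InBloch f → ∀ z ∈ D1,
    (1 - ‖z‖ ^ 2) * ‖deriv u z * f z‖ ≤ C * blochNorm f}

/-- Operator norm of M_{u'} : 𝒟 → A². -/
def opNormDtoA2 (u : ℂ → ℂ) : ℝ :=
  sInf {C : ℝ | 0 ≤ C ∧ ∀ f, InDirichlet f →
    Real.sqrt ((1 / Real.pi) * ∫ z in D1, ‖deriv u z * f z‖ ^ 2) ≤ C * dirichletNorm f}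

/-- The logarithmic weight log(e/(1-|z|²)). -/
def logWeight (z : ℂ) : ℝ := Real.log (Real.exp 1 / (1 - ‖z‖ ^ 2))

/-- Characterization of multipliers of the Bloch space: u ∈ H^∞ and the log condition. -/
def MultBChar (u : ℂ → ℂ) : Prop :=
  (∃ M, ∀ z ∈ D1, ‖u z‖ ≤ M) ∧
  (∃ M, ∀ z ∈ D1, (1 - ‖z‖ ^ 2) * ‖deriv u z‖ * logWeight z ≤ M)

lemma isOpen_D1 : IsOpen D1 := Metric.isOpen_ball
lemma meas_D1 : MeasurableSet D1 := isOpen_D1.measurableSet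
lemma mem_D1 {z : ℂ} : z ∈ D1 ↔ ‖z‖ < 1 := by simp [D1]

/-- normalized `L²` norm on the disc -/
def a2 (g : ℂ → ℂ) : ℝ := Real.sqrt ((1 / Real.pi) * ∫ z in D1, ‖g z‖ ^ 2)

/-- continuous square-integrable functions on the disc -/
def L2D (g : ℂ → ℂ) : Prop := ContinuousOn g D1 ∧ IntegrableOn (fun z => ‖g z‖ ^ 2) D1

lemma a2_nonneg (g : ℂ → ℂ) : 0 ≤ a2 g := Real.sqrt_nonneg _

lemma a2_sq (g : ℂ → ℂ) : a2 g ^ 2 = (1 / Real.pi) * ∫ z in D1, ‖g z‖ ^ 2 := by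
  rw [a2, Real.sq_sqrt]
  have : 0 ≤ ∫ z in D1, ‖g z‖ ^ 2 := integral_nonneg fun z => by positivity
  positivity

lemma a2_congr {g h : ℂ → ℂ} (H : ∀ z ∈ D1, ‖g z‖ = ‖h z‖) : a2 g = a2 h := by
  unfold a2
  rw [setIntegral_congr_fun meas_D1 (g := fun z => ‖h z‖ ^ 2)]
  intro z hz
  simp [H z hz]

lemma L2D.memLp {g : ℂ → ℂ} (hg : L2D g) : MemLp g 2 (volume.restrict D1) :=
  (memLp_two_iff_integrable_sq_norm (hg.1.aestronglyMeasurable meas_D1)).2 hg.2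

lemma a2_eq {g : ℂ → ℂ} (hg : L2D g) :
    a2 g = Real.sqrt (1 / Real.pi) * lpNorm g 2 (volume.restrict D1) := by
  rw [a2, Real.sqrt_mul (by positivity), lpNorm_eq_integral_norm_rpow_toReal (by simp) (by simp)
    hg.memLp.1, Real.sqrt_eq_rpow (∫ z in D1, ‖g z‖ ^ 2)]
  simp

lemma L2D.add {g h : ℂ → ℂ} (hg : L2D g) (hh : L2D h) : L2D (fun z => g z + h z) := by
  have hc : ContinuousOn (fun z => g z + h z) D1 := hg.1.add hh.1
  exact ⟨hc, (memLp_two_iff_integrable_sq_norm (hc.aestronglyMeasurable meas_D1)).1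
    (hg.memLp.add hh.memLp)⟩

lemma a2_add_le {g h : ℂ → ℂ} (hg : L2D g) (hh : L2D h) :
    a2 (fun z => g z + h z) ≤ a2 g + a2 h := by
  rw [a2_eq hg, a2_eq hh, a2_eq (hg.add hh), ← mul_add]
  gcongr
  exact lpNorm_add_le hg.memLp (by norm_num)

lemma L2D_of_le {g h : ℂ → ℂ} {C : ℝ} (hC : 0 ≤ C) (hg : ContinuousOn g D1) (hh : L2D h)
    (H : ∀ z ∈ D1, ‖g z‖ ≤ C * ‖h z‖) : L2D g ∧ a2 g ≤ C * a2 h := by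
  have H2 : ∀ z ∈ D1, ‖g z‖ ^ 2 ≤ C ^ 2 * ‖h z‖ ^ 2 := fun z hz => by
    rw [← mul_pow]; gcongr; exact H z hz
  have hI : IntegrableOn (fun z => C ^ 2 * ‖h z‖ ^ 2) D1 := hh.2.const_mul _
  have h1 : L2D g := by
    refine ⟨hg, Integrable.mono' hI ((hg.norm.pow 2).aestronglyMeasurable meas_D1) ?_⟩
    filter_upwards [ae_restrict_mem meas_D1] with z hz
    simpa using H2 z hz
  refine ⟨h1, ?_⟩
  refine abs_le_of_sq_le_sq' ?_ (mul_nonneg hC (a2_nonneg _)) |>.2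
  rw [mul_pow, a2_sq, a2_sq, mul_left_comm, ← integral_const_mul (C ^ 2)]
  exact mul_le_mul_of_nonneg_left (setIntegral_mono_on h1.2 hI meas_D1 H2) (by positivity)

lemma L2D_zero : L2D (fun _ => 0) := ⟨continuousOn_const, by simp⟩

lemma a2_zero : a2 (fun _ => 0) = 0 := by simp [a2]

lemma L2D_sum {ι : Type*} (s : Finset ι) (g : ι → ℂ → ℂ) (C : ι → ℝ) (hg : ∀ i ∈ s, L2D (g i))
    (hC : ∀ i ∈ s, a2 (g i) ≤ C i) :
    L2D (fun z => ∑ i ∈ s, g i z) ∧ a2 (fun z => ∑ i ∈ s, g i z) ≤ ∑ i ∈ s, C i := by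
  classical
  induction s using Finset.induction_on with
  | empty => simpa using ⟨L2D_zero, a2_zero.le⟩
  | insert i s hi ih =>
    obtain ⟨h1, h2⟩ := ih (fun j hj => hg j (Finset.mem_insert_of_mem hj))
      (fun j hj => hC j (Finset.mem_insert_of_mem hj))
    simp only [Finset.sum_insert hi]
    have h3 := hg i (Finset.mem_insert_self _ _)
    refine ⟨h3.add h1, (a2_add_le h3 h1).trans ?_⟩
    exact add_le_add (hC i (Finset.mem_insert_self _ _)) h2

lemma L2D_cs {g h : ℂ → ℂ} (hg : L2D g) (hh : L2D h) :
    IntegrableOn (fun z => g z * h z) D1 ∧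
    ‖∫ z in D1, g z * h z‖ ≤ Real.pi * (a2 g * a2 h) := by
  have hI : IntegrableOn (fun z => g z * h z) D1 := hg.memLp.integrable_mul hh.memLp
  refine ⟨hI, ?_⟩
  refine (norm_integral_le_integral_norm _).trans ?_
  have e2 : ENNReal.ofReal 2 = 2 := by simp
  have := integral_mul_le_Lp_mul_Lq_of_nonneg (μ := volume.restrict D1) (p := 2) (q := 2)
    (f := fun z => ‖g z‖) (g := fun z => ‖h z‖) (by constructor <;> norm_num)
    (ae_of_all _ fun z => norm_nonneg _) (ae_of_all _ fun z => norm_nonneg _)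
    (by rw [e2]; exact hg.memLp.norm) (by rw [e2]; exact hh.memLp.norm)
  simp only [norm_mul]
  refine this.trans (le_of_eq ?_)
  have hs : Real.sqrt (1 / Real.pi) * Real.sqrt (1 / Real.pi) = 1 / Real.pi :=
    Real.mul_self_sqrt (by positivity)
  rw [a2, a2, Real.sqrt_mul (by positivity), Real.sqrt_mul (by positivity),
    Real.sqrt_eq_rpow (∫ z in D1, ‖g z‖ ^ 2), Real.sqrt_eq_rpow (∫ z in D1, ‖h z‖ ^ 2),
    mul_mul_mul_comm, hs]
  simp only [Real.rpow_ofNat]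
  field_simp

lemma polar_D1 (g : ℂ → ℂ) (hg : ContinuousOn g D1) (hI : IntegrableOn g D1) :
    ∫ z in D1, g z = ∫ r in Ioo (0:ℝ) 1, (r:ℂ) * ∫ θ in (0:ℝ)..2 * Real.pi, g (circleMap 0 r θ) := by
  set F : ℂ → ℂ := D1.indicator g with hF
  have hFm : Measurable F := by
    classical
    have := hg.measurable_piecewise (g := fun _ => (0:ℂ)) continuousOn_const meas_D1
    convert this using 1
    ext z
    simp [F, Set.piecewise, Set.indicator]
  have hsm : Measurable (fun p : ℝ × ℝ => Complex.polarCoord.symm p) := by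
    simp only [Complex.polarCoord_symm_apply]
    fun_prop
  have hFi : Integrable F := (integrable_indicator_iff meas_D1).2 hI
  have hint : IntegrableOn (fun p : ℝ × ℝ => p.1 • F (Complex.polarCoord.symm p))
      (Ioi (0:ℝ) ×ˢ Ioo (-Real.pi) Real.pi) := by
    refine ⟨?_, ?_⟩
    · exact ((measurable_fst.smul (hFm.comp hsm))).aestronglyMeasurable
    · rw [HasFiniteIntegral]
      have h1 := Complex.lintegral_comp_polarCoord_symm (fun z => ‖F z‖ₑ)
      have h2 : ∫⁻ z, ‖F z‖ₑ < ⊤ := hFi.2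
      rw [← h1] at h2
      refine lt_of_le_of_lt (le_of_eq ?_) h2
      rw [polarCoord_target]
      refine setLIntegral_congr_fun (measurableSet_Ioi.prod measurableSet_Ioo) ?_
      rintro ⟨r, θ⟩ ⟨hr, _⟩
      have hr' : (0:ℝ) < r := hr
      simp only [enorm_smul, smul_eq_mul]
      congr 1
      rw [← ofReal_norm, Real.norm_of_nonneg hr'.le]
  rw [← integral_indicator meas_D1, ← hF, ← Complex.integral_comp_polarCoord_symm,
    polarCoord_target, Measure.volume_eq_prod, setIntegral_prod _ hint]
  have hsub : Ioo (0:ℝ) 1 ⊆ Ioi 0 := fun x hx => hx.1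
  refine Eq.trans (setIntegral_eq_of_subset_of_forall_sdiff_eq_zero measurableSet_Ioi hsub ?_) ?_
  rotate_left
  · refine setIntegral_congr_fun measurableSet_Ioo ?_
    rintro r ⟨hr0, hr1⟩
    simp only [real_smul]
    rw [integral_const_mul]
    congr 1
    have hper : Function.Periodic (fun θ : ℝ => g (circleMap 0 r θ)) (2 * Real.pi) :=
      fun θ => by simp only [periodic_circleMap 0 r θ]
    have := hper.intervalIntegral_add_eq 0 (-Real.pi)
    rw [zero_add, show -Real.pi + 2 * Real.pi = Real.pi by ring] at this
    rw [this, intervalIntegral.integral_of_le (by linarith [Real.pi_pos]),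
      ← integral_Ioc_eq_integral_Ioo]
    refine integral_congr_ae (ae_of_all _ fun θ => ?_)
    have : Complex.polarCoord.symm (r, θ) = circleMap 0 r θ := by
      simp [circleMap, Complex.polarCoord_symm_apply, Complex.exp_mul_I]
    simp only [this, F]
    rw [Set.indicator_of_mem]
    simp [mem_D1, abs_of_pos hr0, hr1]
  · rintro r ⟨hr0, hr1⟩
    have hr0' : (0:ℝ) < r := hr0
    have : 1 ≤ r := by
      by_contra h
      exact hr1 ⟨hr0, not_le.1 h⟩
    have hz : ∀ θ : ℝ, F (Complex.polarCoord.symm (r, θ)) = 0 := fun θ => by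
      refine Set.indicator_of_notMem ?_ _
      rw [mem_D1, Complex.norm_polarCoord_symm]
      simp [abs_of_pos hr0', this]
    simp only [hz, smul_zero, integral_zero]

lemma denom_ne {w z : ℂ} (hw : w ∈ D1) (hz : ‖z‖ ≤ 1) : 1 - (starRingEnd ℂ) w * z ≠ 0 := by
  rw [mem_D1] at hw
  intro h
  have h1 : (starRingEnd ℂ) w * z = 1 := (sub_eq_zero.1 h).symm
  have h2 : ‖w‖ * ‖z‖ = 1 := by simpa using congrArg norm h1
  nlinarith [norm_nonneg w, norm_nonneg z]

/-- derivative of the reproducing kernel -/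
def kD (w z : ℂ) : ℂ := (starRingEnd ℂ) w / (1 - (starRingEnd ℂ) w * z)

lemma kD_cont {w : ℂ} (hw : w ∈ D1) : ContinuousOn (kD w) (closedBall 0 1) := by
  unfold kD
  refine ContinuousOn.div continuousOn_const (by fun_prop) fun z hz => denom_ne hw (by simpa using hz)

lemma kD_diff {w : ℂ} (hw : w ∈ D1) : DifferentiableOn ℂ (kD w) D1 := by
  unfold kD
  refine DifferentiableOn.div (by fun_prop) (by fun_prop) fun z hz =>
    denom_ne hw (mem_D1.1 hz).le

lemma L2D_of_cont {g : ℂ → ℂ} (hg : ContinuousOn g (closedBall 0 1)) : L2D g := by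
  refine ⟨hg.mono ball_subset_closedBall, ?_⟩
  exact ((hg.norm.pow 2).integrableOn_compact (isCompact_closedBall 0 1)).mono_set
    ball_subset_closedBall

lemma circle_kernel {G : ℂ → ℂ} (hG : DifferentiableOn ℂ G D1) {w : ℂ} (hw : w ∈ D1) {s : ℝ}
    (hs0 : 0 < s) (hs1 : s < 1) :
    ∫ θ in (0:ℝ)..2 * Real.pi, G (circleMap 0 s θ) * (starRingEnd ℂ) (kD w (circleMap 0 s θ)) =
      2 * Real.pi * (w * G (w * s ^ 2)) := by
  have hw1 := mem_D1.1 hw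
  have hcl : DifferentiableOn ℂ G (closedBall 0 s) := hG.mono (closedBall_subset_ball hs1)
  have hmem : w * (s:ℂ) ^ 2 ∈ ball (0:ℂ) s := by
    simp [abs_of_pos hs0]
    nlinarith [norm_nonneg w, mul_pos hs0 hs0]
  have := hcl.circleIntegral_sub_inv_smul hmem
  rw [circleIntegral] at this
  have key : ∀ θ : ℝ, deriv (circleMap 0 s) θ • ((circleMap 0 s θ - w * s ^ 2)⁻¹ • G (circleMap 0 s θ)) * w
      = I * (G (circleMap 0 s θ) * (starRingEnd ℂ) (kD w (circleMap 0 s θ))) := by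
    intro θ
    set ζ := circleMap 0 s θ with hζ
    have hζn : ‖ζ‖ = s := by simp [hζ, abs_of_pos hs0]
    have hζ0 : ζ ≠ 0 := by rw [← norm_pos_iff, hζn]; exact hs0
    have hζc : (starRingEnd ℂ) ζ * ζ = s ^ 2 := by
      rw [mul_comm, Complex.mul_conj, Complex.normSq_eq_norm_sq, hζn]; push_cast; rfl
    have hd : 1 - (starRingEnd ℂ) w * ζ ≠ 0 := denom_ne hw (by linarith)
    have hd2 : 1 - w * (starRingEnd ℂ) ζ ≠ 0 := by
      intro h; apply hd
      have := congrArg (starRingEnd ℂ) h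
      simpa using this
    have hd3 : ζ - w * s ^ 2 ≠ 0 := by
      rw [← hζc, show ζ - w * ((starRingEnd ℂ) ζ * ζ) = (1 - w * (starRingEnd ℂ) ζ) * ζ by ring]
      exact mul_ne_zero hd2 hζ0
    simp only [deriv_circleMap, smul_eq_mul, kD, map_div₀, map_sub, map_mul, map_one,
      Complex.conj_conj]
    rw [← hζ]
    field_simp
    rw [← hζc]
    ring
  have h2 := congrArg (fun x => x * w) this
  rw [← intervalIntegral.integral_mul_const] at h2
  simp only [key] at h2
  rw [intervalIntegral.integral_const_mul] at h2
  have hI : I ≠ 0 := Complex.I_ne_zero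
  apply mul_left_cancel₀ hI
  rw [h2, smul_eq_mul]
  ring

lemma repro {G : ℂ → ℂ} (hG : DifferentiableOn ℂ G D1) (hL : L2D G) {w : ℂ} (hw : w ∈ D1) :
    ∫ z in D1, G z * (starRingEnd ℂ) (kD w z) = Real.pi * ∫ t in (0:ℝ)..1, w * G (w * t) := by
  have hkc : ContinuousOn (fun z => (starRingEnd ℂ) (kD w z)) (closedBall 0 1) :=
    Complex.continuous_conj.comp_continuousOn (kD_cont hw)
  have hk : L2D (fun z => (starRingEnd ℂ) (kD w z)) := L2D_of_cont hkc
  rw [polar_D1 (fun z => G z * (starRingEnd ℂ) (kD w z)) (hL.1.mul hk.1) (L2D_cs hL hk).1]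
  rw [setIntegral_congr_fun measurableSet_Ioo
    (g := fun s : ℝ => (Real.pi : ℂ) * ((2 * s : ℝ) • (w * G (w * ((s ^ 2 : ℝ) : ℂ)))))]
  · rw [integral_const_mul]
    congr 1
    rw [← integral_Ioc_eq_integral_Ioo, ← intervalIntegral.integral_of_le zero_le_one]
    have hmem : ∀ t ∈ Icc (0:ℝ) 1, w * (t:ℂ) ∈ D1 := by
      intro t ht
      rw [mem_D1] at *
      simp only [norm_mul, norm_real, Real.norm_eq_abs, abs_of_nonneg ht.1]
      nlinarith [ht.1, ht.2, norm_nonneg w]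
    have := intervalIntegral.integral_deriv_smul_comp' (a := 0) (b := 1) (f := fun s : ℝ => s ^ 2)
      (f' := fun s => 2 * s) (g := fun t : ℝ => w * G (w * (t:ℂ))) ?_ (by fun_prop) ?_
    · simpa using this
    · intro x _
      simpa using hasDerivAt_pow 2 x
    · have hc : ContinuousOn (fun t : ℝ => w * G (w * (t:ℂ))) (Icc 0 1) :=
        continuousOn_const.mul (hG.continuousOn.comp (by fun_prop) hmem)
      refine hc.mono ?_
      rintro _ ⟨x, hx, rfl⟩
      rw [Set.uIcc_of_le zero_le_one] at hx
      exact ⟨by positivity, pow_le_one₀ hx.1 hx.2⟩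
  · rintro s ⟨hs0, hs1⟩
    simp only
    rw [circle_kernel hG hw hs0 hs1, real_smul]
    push_cast
    ring

lemma smul_mem_D1 {w : ℂ} (hw : w ∈ D1) {t : ℝ} (ht : t ∈ Set.Icc (0:ℝ) 1) : w * (t:ℂ) ∈ D1 := by
  rw [mem_D1] at *
  simp only [norm_mul, norm_real, Real.norm_eq_abs, abs_of_nonneg ht.1]
  nlinarith [ht.1, ht.2, norm_nonneg w]

lemma deriv_diffOn {f : ℂ → ℂ} (hf : AnalyticOnD f) : DifferentiableOn ℂ (deriv f) D1 :=
  DifferentiableOn.deriv hf isOpen_D1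

lemma hasDeriv {f : ℂ → ℂ} (hf : AnalyticOnD f) {z : ℂ} (hz : z ∈ D1) :
    HasDerivAt f (deriv f z) z :=
  (hf.differentiableAt (isOpen_D1.mem_nhds hz)).hasDerivAt

lemma ftc_ray {f : ℂ → ℂ} (hf : AnalyticOnD f) {w : ℂ} (hw : w ∈ D1) :
    ∫ t in (0:ℝ)..1, w * deriv f (w * t) = f w - f 0 := by
  have hc : ContinuousOn (fun t : ℝ => w * deriv f (w * (t:ℂ))) (Set.uIcc 0 1) := by
    rw [Set.uIcc_of_le zero_le_one]
    exact continuousOn_const.mul ((deriv_diffOn hf).continuousOn.comp (by fun_prop)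
      fun t ht => smul_mem_D1 hw ht)
  rw [intervalIntegral.integral_eq_sub_of_hasDerivAt (f := fun t : ℝ => f (w * (t:ℂ))) ?_
    hc.intervalIntegrable]
  · simp
  · intro t ht
    rw [Set.uIcc_of_le zero_le_one] at ht
    have h1 := hasDeriv hf (smul_mem_D1 hw ht)
    have h2 : HasDerivAt (fun t : ℝ => w * (t:ℂ)) w t := by
      simpa using (Complex.ofRealCLM.hasDerivAt (x := t)).const_mul w
    have := h1.comp t h2
    rw [mul_comm]
    exact this

lemma a2_kD {w : ℂ} (hw : w ∈ D1) : a2 (kD w) ^ 2 = -Real.log (1 - ‖w‖ ^ 2) := by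
  have hw1 := mem_D1.1 hw
  have hp : ∀ t ∈ Set.Icc (0:ℝ) 1, 0 < 1 - ‖w‖ ^ 2 * t := by
    intro t ht
    have : ‖w‖ ^ 2 < 1 := by nlinarith [norm_nonneg w]
    nlinarith [ht.1, ht.2, sq_nonneg ‖w‖]
  have h := repro (kD_diff hw) (L2D_of_cont (kD_cont hw)) hw
  have h1 : ∀ z, kD w z * (starRingEnd ℂ) (kD w z) = ((‖kD w z‖ ^ 2 : ℝ) : ℂ) := fun z => by
    rw [Complex.mul_conj, Complex.normSq_eq_norm_sq]
  have h2 : ∀ t : ℝ, w * kD w (w * t) = ((‖w‖ ^ 2 / (1 - ‖w‖ ^ 2 * t) : ℝ) : ℂ) := fun t => by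
    have e : (starRingEnd ℂ) w * w = ((‖w‖ ^ 2 : ℝ) : ℂ) := by
      rw [mul_comm, Complex.mul_conj, Complex.normSq_eq_norm_sq]
    rw [kD, ← mul_assoc, e, mul_div_assoc', mul_comm w, e]
    push_cast; rfl
  simp only [h1, h2] at h
  rw [integral_complex_ofReal, intervalIntegral.integral_ofReal] at h
  have h3 : ∫ z in D1, ‖kD w z‖ ^ 2 = Real.pi * ∫ t in (0:ℝ)..1, ‖w‖ ^ 2 / (1 - ‖w‖ ^ 2 * t) := by
    exact_mod_cast h
  have h4 : ∫ t in (0:ℝ)..1, ‖w‖ ^ 2 / (1 - ‖w‖ ^ 2 * t) = -Real.log (1 - ‖w‖ ^ 2) := by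
    rw [intervalIntegral.integral_eq_sub_of_hasDerivAt
      (f := fun t : ℝ => -Real.log (1 - ‖w‖ ^ 2 * t))]
    · simp
    · intro t ht
      rw [Set.uIcc_of_le zero_le_one] at ht
      have hd : HasDerivAt (fun t : ℝ => 1 - ‖w‖ ^ 2 * t) (-(‖w‖ ^ 2)) t := by
        simpa using ((hasDerivAt_id t).const_mul (‖w‖ ^ 2)).const_sub 1
      have := (hd.log (hp t ht).ne').neg
      rw [neg_div, neg_neg] at this
      exact this
    · refine ContinuousOn.intervalIntegrable ?_
      rw [Set.uIcc_of_le zero_le_one]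
      exact continuousOn_const.div (by fun_prop) fun t ht => (hp t ht).ne'
  rw [a2_sq, h3, h4]
  have := Real.pi_pos
  field_simp

lemma InDirichlet.L2D {f : ℂ → ℂ} (hf : InDirichlet f) : L2D (deriv f) :=
  ⟨(deriv_diffOn hf.1).continuousOn, hf.2⟩

lemma dirNormSq (f : ℂ → ℂ) : dirichletNormSq f = ‖f 0‖ ^ 2 + a2 (deriv f) ^ 2 := by
  rw [a2_sq, dirichletNormSq]

lemma dirNorm_sq (f : ℂ → ℂ) : dirichletNorm f ^ 2 = ‖f 0‖ ^ 2 + a2 (deriv f) ^ 2 := by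
  rw [dirichletNorm, dirNormSq, Real.sq_sqrt (by positivity)]

lemma dirNorm_nonneg (f : ℂ → ℂ) : 0 ≤ dirichletNorm f := Real.sqrt_nonneg _

lemma a2_le_dir (f : ℂ → ℂ) : a2 (deriv f) ≤ dirichletNorm f := by
  refine abs_le_of_sq_le_sq' ?_ (dirNorm_nonneg f) |>.2
  rw [dirNorm_sq]; nlinarith [sq_nonneg ‖f 0‖]

lemma zero_le_dir (f : ℂ → ℂ) : ‖f 0‖ ≤ dirichletNorm f := by
  refine abs_le_of_sq_le_sq' ?_ (dirNorm_nonneg f) |>.2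
  rw [dirNorm_sq]; nlinarith [sq_nonneg (a2 (deriv f))]

lemma dir_le_add (f : ℂ → ℂ) : dirichletNorm f ≤ ‖f 0‖ + a2 (deriv f) := by
  have h1 := norm_nonneg (f 0)
  have h2 := a2_nonneg (deriv f)
  refine abs_le_of_sq_le_sq' ?_ (by positivity) |>.2
  rw [dirNorm_sq]; nlinarith [mul_nonneg h1 h2]

lemma pointwise {f : ℂ → ℂ} (hf : InDirichlet f) {w : ℂ} (hw : w ∈ D1) :
    ‖f w‖ ^ 2 ≤ (1 - Real.log (1 - ‖w‖ ^ 2)) * dirichletNorm f ^ 2 := by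
  have h1 := repro (deriv_diffOn hf.1) hf.L2D hw
  rw [ftc_ray hf.1 hw] at h1
  have hkc : ContinuousOn (fun z => (starRingEnd ℂ) (kD w z)) (closedBall 0 1) :=
    Complex.continuous_conj.comp_continuousOn (kD_cont hw)
  have h2 := (L2D_cs hf.L2D (L2D_of_cont hkc)).2
  rw [h1, a2_congr (g := fun z => (starRingEnd ℂ) (kD w z)) (h := kD w) (fun z _ => by simp),
    norm_mul, norm_real, Real.norm_of_nonneg Real.pi_pos.le] at h2
  have h3 : ‖f w - f 0‖ ≤ a2 (deriv f) * a2 (kD w) := le_of_mul_le_mul_left h2 Real.pi_pos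
  have h4 : ‖f w‖ ≤ ‖f 0‖ + a2 (deriv f) * a2 (kD w) := by
    have := norm_add_le (f 0) (f w - f 0)
    rw [add_sub_cancel] at this
    linarith
  have h5 := a2_kD hw
  rw [dirNorm_sq, sub_eq_add_neg, ← h5]
  have h6 : ‖f w‖ ^ 2 ≤ (‖f 0‖ + a2 (deriv f) * a2 (kD w)) ^ 2 := by gcongr
  nlinarith [sq_nonneg (a2 (deriv f) - ‖f 0‖ * a2 (kD w))]

lemma det_lem (c : ℂ) :
    ((ContinuousLinearMap.toSpanSingleton ℂ c : ℂ →L[ℂ] ℂ).restrictScalars ℝ).det = ‖c‖ ^ 2 := by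
  simp [ContinuousLinearMap.det, LinearMap.det_restrictScalars,
      Algebra.norm_complex_eq, Complex.normSq_eq_norm_sq]

/-- change of variables -/
lemma cov {Φ Ψ : ℂ → ℂ} (hΦ : AnalyticOnD Φ) (h1 : Set.MapsTo Φ D1 D1) (h2 : Set.MapsTo Ψ D1 D1)
    (h3 : ∀ z ∈ D1, Ψ (Φ z) = z) (h4 : ∀ z ∈ D1, Φ (Ψ z) = z) {g : ℂ → ℂ} (hg : L2D g) :
    L2D (fun z => g (Φ z) * deriv Φ z) ∧ a2 (fun z => g (Φ z) * deriv Φ z) = a2 g := by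
  have him : Φ '' D1 = D1 := by
    apply Set.Subset.antisymm
    · rintro _ ⟨z, hz, rfl⟩; exact h1 hz
    · intro z hz; exact ⟨Ψ z, h2 hz, h4 z hz⟩
  have hinj : Set.InjOn Φ D1 := fun x hx y hy hxy => by rw [← h3 x hx, hxy, h3 y hy]
  have hfd : ∀ x ∈ D1, HasFDerivWithinAt Φ
      ((ContinuousLinearMap.toSpanSingleton ℂ (deriv Φ x) : ℂ →L[ℂ] ℂ).restrictScalars ℝ) D1 x :=
    fun x hx => ((hasDeriv hΦ hx).hasFDerivAt.restrictScalars ℝ).hasFDerivWithinAt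
  have e : ∀ z, |((ContinuousLinearMap.toSpanSingleton ℂ (deriv Φ z) : ℂ →L[ℂ] ℂ).restrictScalars ℝ).det|
      • ‖g (Φ z)‖ ^ 2 = ‖g (Φ z) * deriv Φ z‖ ^ 2 := fun z => by
    rw [det_lem, abs_of_nonneg (by positivity), norm_mul, smul_eq_mul]; ring
  have i1 := integrableOn_image_iff_integrableOn_abs_det_fderiv_smul volume meas_D1 hfd hinj
    (fun z => ‖g z‖ ^ 2)
  have i2 := integral_image_eq_integral_abs_det_fderiv_smul volume meas_D1 hfd hinj
    (fun z => ‖g z‖ ^ 2)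
  simp only [e] at i1 i2
  rw [him] at i1 i2
  refine ⟨⟨(hg.1.comp hΦ.continuousOn h1).mul (deriv_diffOn hΦ).continuousOn, i1.1 hg.2⟩, ?_⟩
  rw [a2, a2, i2]

lemma comp_dir {f Φ Ψ : ℂ → ℂ} (hf : InDirichlet f) (hΦ : AnalyticOnD Φ) (h1 : Set.MapsTo Φ D1 D1)
    (h2 : Set.MapsTo Ψ D1 D1) (h3 : ∀ z ∈ D1, Ψ (Φ z) = z) (h4 : ∀ z ∈ D1, Φ (Ψ z) = z) :
    InDirichlet (fun z => f (Φ z)) ∧ dirichletNorm (fun z => f (Φ z)) ^ 2 ≤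
      (2 - Real.log (1 - ‖Φ 0‖ ^ 2)) * dirichletNorm f ^ 2 := by
  have hd : ∀ z ∈ D1, deriv (fun z => f (Φ z)) z = deriv f (Φ z) * deriv Φ z := fun z hz =>
    ((hasDeriv hf.1 (h1 hz)).comp z (hasDeriv hΦ hz)).deriv
  obtain ⟨c1, c2⟩ := cov hΦ h1 h2 h3 h4 hf.L2D
  have h0 : (0:ℂ) ∈ D1 := by simp [mem_D1]
  refine ⟨⟨hf.1.comp hΦ h1, ?_⟩, ?_⟩
  · refine (integrableOn_congr_fun ?_ meas_D1).1 c1.2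
    intro z hz
    simp only [hd z hz]
  · rw [dirNorm_sq, a2_congr (fun z hz => by rw [hd z hz]), c2]
    have := pointwise hf (h1 h0)
    nlinarith [a2_le_dir f, a2_nonneg (deriv f), dirNorm_nonneg f]

/-- involutive Moebius map -/
def mob (a v : ℂ) : ℂ := (a - v) / (1 - (starRingEnd ℂ) a * v)

lemma mob_id {a v : ℂ} (ha : a ∈ D1) (hv : v ∈ D1) :
    1 - ‖mob a v‖ ^ 2 = (1 - ‖a‖ ^ 2) * (1 - ‖v‖ ^ 2) / ‖1 - (starRingEnd ℂ) a * v‖ ^ 2 := by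
  have hd : ‖1 - (starRingEnd ℂ) a * v‖ ^ 2 ≠ 0 := by
    have := denom_ne ha (mem_D1.1 hv).le
    positivity
  rw [mob, norm_div, div_pow, eq_div_iff hd, sub_mul, div_mul_cancel₀ _ hd]
  simp only [← Complex.normSq_eq_norm_sq, Complex.normSq_apply]
  simp
  ring

lemma mob_ge {a v : ℂ} (ha : a ∈ D1) (hv : v ∈ D1) :
    (1 - ‖v‖ ^ 2) * ((1 - ‖a‖) / (1 + ‖a‖)) ≤ 1 - ‖mob a v‖ ^ 2 := by
  have ha' := mem_D1.1 ha
  have hv' := mem_D1.1 hv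
  have hd : 0 < ‖1 - (starRingEnd ℂ) a * v‖ := norm_pos_iff.2 (denom_ne ha hv'.le)
  have h1 : ‖1 - (starRingEnd ℂ) a * v‖ ≤ 1 + ‖a‖ := by
    refine (norm_sub_le _ _).trans ?_
    simp
    nlinarith [norm_nonneg a, norm_nonneg v]
  have hv2 : 0 < 1 - ‖v‖ ^ 2 := by nlinarith [norm_nonneg v]
  have ha2 : 0 < 1 - ‖a‖ ^ 2 := by nlinarith [norm_nonneg a]
  have ha3 := norm_nonneg a
  rw [mob_id ha hv]
  calc (1 - ‖v‖ ^ 2) * ((1 - ‖a‖) / (1 + ‖a‖))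
      = (1 - ‖a‖ ^ 2) * (1 - ‖v‖ ^ 2) / (1 + ‖a‖) ^ 2 := by field_simp; ring
    _ ≤ _ := by gcongr

lemma mob_mem {a v : ℂ} (ha : a ∈ D1) (hv : v ∈ D1) : mob a v ∈ D1 := by
  have h := mob_ge ha hv
  have ha' := mem_D1.1 ha
  have hv' := mem_D1.1 hv
  have hv2 : 0 < 1 - ‖v‖ ^ 2 := by nlinarith [norm_nonneg v]
  have h2 : 0 < (1 - ‖a‖) / (1 + ‖a‖) := div_pos (by linarith) (by positivity)
  have := mul_pos hv2 h2
  rw [mem_D1]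
  nlinarith [norm_nonneg (mob a v)]

lemma mob_mob {a v : ℂ} (ha : a ∈ D1) (hv : v ∈ D1) : mob a (mob a v) = v := by
  have hd := denom_ne ha (mem_D1.1 hv).le
  have hd2 := denom_ne ha (mem_D1.1 (mob_mem ha hv)).le
  have hx : mob a v * (1 - (starRingEnd ℂ) a * v) = a - v := div_mul_cancel₀ _ hd
  rw [mob, div_eq_iff hd2]
  linear_combination -hx

lemma mob_diff {a : ℂ} (ha : a ∈ D1) : AnalyticOnD (mob a) := by
  unfold mob AnalyticOnD
  exact DifferentiableOn.div (by fun_prop) (by fun_prop) fun z hz => denom_ne ha (mem_D1.1 hz).le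

lemma rot_mem {l v : ℂ} (hl : ‖l‖ = 1) (hv : v ∈ D1) : l * v ∈ D1 := by
  rw [mem_D1] at *; simpa [hl] using hv

lemma iter_diff {f : ℂ → ℂ} (hf : AnalyticOnD f) (hm : Set.MapsTo f D1 D1) (j : ℕ) :
    AnalyticOnD (f^[j]) := by
  induction j with
  | zero => exact differentiableOn_id
  | succ j ih => rw [Function.iterate_succ]; exact DifferentiableOn.comp ih hf hm

lemma iter_inv {f g : ℂ → ℂ} (hm : Set.MapsTo f D1 D1) (h : ∀ z ∈ D1, g (f z) = z) (j : ℕ) :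
    ∀ z ∈ D1, g^[j] (f^[j] z) = z := by
  induction j with
  | zero => intro z _; rfl
  | succ j ih =>
    intro z hz
    rw [Function.iterate_succ_apply', Function.iterate_succ_apply]
    rw [ih (f z) (hm hz), h z hz]

/-- the inverse automorphism -/
def psi (lam a w : ℂ) : ℂ := mob a ((starRingEnd ℂ) lam * w)

lemma psi_iter {lam a : ℂ} (hlam : ‖lam‖ = 1) (ha : a ∈ D1) (j : ℕ) :
    ((1 - ‖a‖) / (1 + ‖a‖)) ^ j ≤ 1 - ‖(psi lam a)^[j] 0‖ ^ 2 ∧ (psi lam a)^[j] 0 ∈ D1 := by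
  have ha' := mem_D1.1 ha
  have h2 : 0 < (1 - ‖a‖) / (1 + ‖a‖) := div_pos (by linarith) (by positivity)
  induction j with
  | zero => simp [mem_D1]
  | succ j ih =>
    obtain ⟨h, hm⟩ := ih
    have hr : (starRingEnd ℂ) lam * (psi lam a)^[j] 0 ∈ D1 := rot_mem (by simpa using hlam) hm
    rw [Function.iterate_succ_apply']
    refine ⟨?_, mob_mem ha hr⟩
    refine le_trans ?_ (mob_ge ha hr)
    rw [pow_succ, norm_mul, RCLike.norm_conj, hlam, one_mul]
    gcongr

lemma hyp_nonneg {a : ℂ} (ha : a ∈ D1) : 0 ≤ hypDist a 0 := by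
  have ha' := mem_D1.1 ha
  unfold hypDist
  simp only [sub_zero, mul_zero, div_one]
  have : 0 ≤ Real.log ((1 + ‖a‖) / (1 - ‖a‖)) := by
    apply Real.log_nonneg
    rw [le_div_iff₀ (by linarith)]
    linarith [norm_nonneg a]
  linarith

lemma psi_log {lam a : ℂ} (hlam : ‖lam‖ = 1) (ha : a ∈ D1) (j : ℕ) :
    -Real.log (1 - ‖(psi lam a)^[j] 0‖ ^ 2) ≤ 2 * (j * hypDist a 0) := by
  have ha' := mem_D1.1 ha
  have h2 : 0 < (1 - ‖a‖) / (1 + ‖a‖) := div_pos (by linarith) (by positivity)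
  have h := Real.log_le_log (by positivity) (psi_iter hlam ha j).1
  rw [Real.log_pow] at h
  have e : hypDist a 0 = -(1 / 2) * Real.log ((1 - ‖a‖) / (1 + ‖a‖)) := by
    unfold hypDist
    simp only [sub_zero, mul_zero, div_one]
    rw [← inv_div (1 - ‖a‖), Real.log_inv]
    ring
  rw [e]
  linarith

lemma mult_bdd {u : ℂ → ℂ} (hmult : BddOnDirichlet (mult u)) :
    ∃ C, 0 ≤ C ∧ (∀ z ∈ D1, ‖u z‖ ≤ C) ∧
      ∀ f, InDirichlet f → InDirichlet (mult u f) ∧ dirichletNorm (mult u f) ≤ C * dirichletNorm f := by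
  obtain ⟨C₀, hC₀⟩ := hmult
  set C := max C₀ 1 with hC
  have hC1 : 1 ≤ C := le_max_right _ _
  have hCC : ∀ f, InDirichlet f → InDirichlet (mult u f) ∧
      dirichletNorm (mult u f) ≤ C * dirichletNorm f := fun f hf =>
    ⟨(hC₀ f hf).1, (hC₀ f hf).2.trans
      (mul_le_mul_of_nonneg_right (le_max_left _ _) (dirNorm_nonneg f))⟩
  refine ⟨C, by linarith, ?_, hCC⟩
  have hpow : ∀ n : ℕ, InDirichlet (fun z => u z ^ n) ∧ dirichletNorm (fun z => u z ^ n) ≤ C ^ n := by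
    intro n
    induction n with
    | zero =>
      refine ⟨⟨?_, ?_⟩, ?_⟩
      · simp [AnalyticOnD]
      · simp
      · simp [dirichletNorm, dirichletNormSq]
    | succ n ih =>
      have := hCC _ ih.1
      have e : mult u (fun z => u z ^ n) = fun z => u z ^ (n + 1) := by
        ext z; simp [mult, pow_succ, mul_comm]
      rw [e] at this
      refine ⟨this.1, this.2.trans ?_⟩
      rw [pow_succ']
      exact mul_le_mul_of_nonneg_left ih.2 (by linarith)
  intro z hz
  by_contra hlt
  push Not at hlt
  have hC0 : 0 < C := by linarith
  set x := (‖u z‖ / C) ^ 2 with hx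
  have hx1 : 1 < x := by
    have : 1 < ‖u z‖ / C := (one_lt_div hC0).2 hlt
    rw [hx]; nlinarith
  obtain ⟨n, hn⟩ := pow_unbounded_of_one_lt (1 - Real.log (1 - ‖z‖ ^ 2)) hx1
  have h1 := pointwise (hpow n).1 hz
  have h2 : dirichletNorm (fun z => u z ^ n) ^ 2 ≤ (C ^ n) ^ 2 := by
    have := (hpow n).2
    have := dirNorm_nonneg (fun z => u z ^ n)
    gcongr
  have h0 : 0 ≤ 1 - Real.log (1 - ‖z‖ ^ 2) := by
    have := mem_D1.1 hz
    have := Real.log_nonpos (x := 1 - ‖z‖ ^ 2) (by nlinarith [norm_nonneg z]) (by nlinarith [norm_nonneg z])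
    linarith
  have h3 : (‖u z‖ ^ n) ^ 2 ≤ (1 - Real.log (1 - ‖z‖ ^ 2)) * (C ^ n) ^ 2 := by
    rw [norm_pow] at h1
    exact h1.trans (mul_le_mul_of_nonneg_left h2 h0)
  have h4 : x ^ n = (‖u z‖ ^ n) ^ 2 / (C ^ n) ^ 2 := by
    rw [hx, ← pow_mul, div_pow, ← pow_mul, ← pow_mul, mul_comm]
  rw [h4, lt_div_iff₀ (by positivity)] at hn
  linarith

lemma deriv_mult {u f : ℂ → ℂ} (hu : AnalyticOnD u) (hf : AnalyticOnD f) {z : ℂ} (hz : z ∈ D1) :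
    deriv (mult u f) z = deriv u z * f z + u z * deriv f z :=
  ((hasDeriv hu hz).mul (hasDeriv hf hz)).deriv

lemma opA2 {u : ℂ → ℂ} (hu : AnalyticOnD u) (hmult : BddOnDirichlet (mult u)) {f : ℂ → ℂ}
    (hf : InDirichlet f) : L2D (fun z => deriv u z * f z) ∧
      a2 (fun z => deriv u z * f z) ≤ opNormDtoA2 u * dirichletNorm f := by
  obtain ⟨C, hC0, hCu, hC⟩ := mult_bdd hmult
  have key : ∀ f, InDirichlet f → L2D (fun z => deriv u z * f z) ∧
      a2 (fun z => deriv u z * f z) ≤ (C + C) * dirichletNorm f := by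
    intro f hf
    have h1 := (hC f hf).1.L2D
    obtain ⟨h2, h3⟩ := L2D_of_le (g := fun z => -(u z * deriv f z)) hC0
      ((hu.continuousOn.mul hf.L2D.1).neg) hf.L2D (fun z hz => by
        rw [norm_neg, norm_mul]
        exact mul_le_mul_of_nonneg_right (hCu z hz) (norm_nonneg _))
    have h4 := h1.add h2
    have h5 := a2_add_le h1 h2
    have hcont : ContinuousOn (fun z => deriv u z * f z) D1 :=
      (deriv_diffOn hu).continuousOn.mul hf.1.continuousOn
    have h6 := L2D_of_le (g := fun z => deriv u z * f z) zero_le_one hcont h4 (fun z hz => by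
      rw [deriv_mult hu hf.1 hz, one_mul]
      apply le_of_eq
      congr 1
      ring)
    refine ⟨h6.1, h6.2.trans ?_⟩
    have h7 := a2_le_dir (mult u f)
    have h8 := (hC f hf).2
    have h9 := mul_le_mul_of_nonneg_left (a2_le_dir f) hC0
    linarith
  refine ⟨(key f hf).1, ?_⟩
  have hne : {C : ℝ | 0 ≤ C ∧ ∀ f, InDirichlet f →
    Real.sqrt ((1 / Real.pi) * ∫ z in D1, ‖deriv u z * f z‖ ^ 2) ≤ C * dirichletNorm f}.Nonempty :=
    ⟨C + C, by linarith, fun f hf => (key f hf).2⟩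
  rcases (dirNorm_nonneg f).eq_or_lt with h | h
  · have := (key f hf).2
    rw [← h] at this ⊢
    simpa using this
  · rw [← div_le_iff₀ h]
    refine le_csInf hne ?_
    rintro c ⟨_, hc⟩
    rw [div_le_iff₀ h]
    exact hc f hf

lemma opA2_nonneg (u : ℂ → ℂ) : 0 ≤ opNormDtoA2 u := Real.sInf_nonneg fun _ h => h.1

lemma le_supNormD {f : ℂ → ℂ} {M : ℝ} (h : ∀ z ∈ D1, ‖f z‖ ≤ M) {z : ℂ} (hz : z ∈ D1) :
    ‖f z‖ ≤ supNormD f :=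
  le_ciSup (f := fun z : D1 => ‖f (z:ℂ)‖) ⟨M, by rintro _ ⟨z, rfl⟩; exact h z z.2⟩ ⟨z, hz⟩

lemma supNormD_nonneg (f : ℂ → ℂ) : 0 ≤ supNormD f := Real.iSup_nonneg fun _ => norm_nonneg _

/-- norm estimate for M_{u_{(n)}} on the Dirichlet space. -/
theorem stmt_18 (u φ : ℂ → ℂ) (lam a : ℂ) (hu : AnalyticOnD u)
    (hmult : BddOnDirichlet (mult u)) (hb : BoundedAwayFromZero u)
    (hlam : ‖lam‖ = 1) (ha : a ∈ D1)
    (hφ : ∀ z, φ z = lam * (a - z) / (1 - (starRingEnd ℂ) a * z)) :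
    ∀ n : ℕ, 1 ≤ n →
      opNormDir (mult (wprod u φ n)) ≤
        (Real.sqrt 2 * opNormDtoA2 u * supNormD (fun z => (u z)⁻¹) + 2) * n *
          Real.sqrt (1 + n * hypDist a 0) * supNormD (wprod u φ n) := by
  intro n hn
  obtain ⟨C, hC0, hCu, -⟩ := mult_bdd hmult
  obtain ⟨δ, hδ, hδu⟩ := hb
  have hu0 : ∀ z ∈ D1, u z ≠ 0 := fun z hz => norm_pos_iff.1 (hδ.trans_le (hδu z hz))
  have hφm : φ = fun z => lam * mob a z := by
    ext z; rw [hφ, mob, mul_div_assoc]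
  have hll : (starRingEnd ℂ) lam * lam = 1 := by
    rw [mul_comm, Complex.mul_conj, Complex.normSq_eq_norm_sq, hlam]; simp
  have φm : Set.MapsTo φ D1 D1 := fun z hz => by
    rw [hφm]; exact rot_mem hlam (mob_mem ha hz)
  have ψm : Set.MapsTo (psi lam a) D1 D1 := fun z hz =>
    mob_mem ha (rot_mem (by simpa using hlam) hz)
  have φd : AnalyticOnD φ := by rw [hφm]; exact (mob_diff ha).const_mul lam
  have ψd : AnalyticOnD (psi lam a) :=
    (mob_diff ha).comp (by fun_prop) fun z hz => rot_mem (by simpa using hlam) hz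
  have ψφ : ∀ z ∈ D1, psi lam a (φ z) = z := fun z hz => by
    simp only [hφm, psi]
    rw [← mul_assoc, hll, one_mul, mob_mob ha hz]
  have φψ : ∀ z ∈ D1, φ (psi lam a z) = z := fun z hz => by
    simp only [hφm, psi]
    rw [mob_mob ha (rot_mem (by simpa using hlam) hz), ← mul_assoc, mul_comm lam, hll, one_mul]
  have φjm := fun j => φm.iterate j
  have ψjm := fun j => ψm.iterate j
  have φjd := fun j => iter_diff φd φm j
  have ψjd := fun j => iter_diff ψd ψm j
  have ψφj := fun j => iter_inv φm ψφ j
  have φψj := fun j => iter_inv ψm φψ j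
  set K := opNormDtoA2 u with hK
  have hK0 : 0 ≤ K := opA2_nonneg u
  set V := supNormD (fun z => (u z)⁻¹) with hV
  have hV0 : 0 ≤ V := supNormD_nonneg _
  have hVle : ∀ z ∈ D1, ‖(u z)⁻¹‖ ≤ V := fun z hz =>
    le_supNormD (f := fun z => (u z)⁻¹) (M := δ⁻¹) (fun z hz => by
      rw [norm_inv]; exact inv_anti₀ hδ (hδu z hz)) hz
  set W := supNormD (wprod u φ n) with hW
  have hW0 : 0 ≤ W := supNormD_nonneg _
  have hWle : ∀ z ∈ D1, ‖wprod u φ n z‖ ≤ W := fun z hz =>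
    le_supNormD (M := C ^ n) (fun z hz => by
      rw [wprod, norm_prod]
      refine (Finset.prod_le_prod (fun _ _ => norm_nonneg _)
        (fun j _ => hCu _ (φjm j hz))).trans ?_
      simp) hz
  set ρ := hypDist a 0 with hρ
  have hρ0 : 0 ≤ ρ := hyp_nonneg ha
  set S := Real.sqrt (1 + n * ρ) with hS
  have hS1 : 1 ≤ S := by
    rw [hS, Real.one_le_sqrt]
    have : 0 ≤ (n:ℝ) * ρ := by positivity
    linarith
  have hn1 : (1:ℝ) ≤ n := by exact_mod_cast hn
  have hujd : ∀ j, AnalyticOnD (fun z => u (φ^[j] z)) := fun j => hu.comp (φjd j) (φjm j)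
  have hwd : AnalyticOnD (wprod u φ n) := by
    unfold wprod AnalyticOnD
    exact DifferentiableOn.fun_finsetProd fun j _ => hujd j
  -- derivative of the weight
  have hwderiv : ∀ z ∈ D1, deriv (wprod u φ n) z =
      ∑ j ∈ Finset.range n, (wprod u φ n z * (u (φ^[j] z))⁻¹) *
        (deriv u (φ^[j] z) * deriv (φ^[j]) z) := by
    intro z hz
    have h := HasDerivAt.fun_finsetProd (u := Finset.range n) (f := fun j z => u (φ^[j] z))
      (f' := fun j => deriv u (φ^[j] z) * deriv (φ^[j]) z) (x := z)
      (fun j _ => (hasDeriv hu (φjm j hz)).comp z (hasDeriv (φjd j) hz))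
    have h' : deriv (wprod u φ n) z = _ := h.deriv
    rw [h']
    refine Finset.sum_congr rfl fun j hj => ?_
    rw [smul_eq_mul]
    congr 1
    have hne := hu0 _ (φjm j hz)
    rw [eq_mul_inv_iff_mul_eq₀ hne]
    exact Finset.prod_erase_mul _ _ hj
  refine csInf_le ⟨0, fun _ h => h.1⟩ ⟨by positivity, ?_⟩
  intro f hf
  set d := dirichletNorm f with hd
  have hd0 : 0 ≤ d := dirNorm_nonneg f
  -- terms of the sum
  have hterm : ∀ j ∈ Finset.range n,
      L2D (fun z => (wprod u φ n z * (u (φ^[j] z))⁻¹) *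
        (deriv u (φ^[j] z) * deriv (φ^[j]) z) * f z) ∧
      a2 (fun z => (wprod u φ n z * (u (φ^[j] z))⁻¹) *
        (deriv u (φ^[j] z) * deriv (φ^[j]) z) * f z) ≤ W * V * (K * (Real.sqrt 2 * S * d)) := by
    intro j hj
    have hjn : (j:ℝ) ≤ n := by exact_mod_cast (Finset.mem_range.1 hj).le
    obtain ⟨c1, c2⟩ := comp_dir hf (ψjd j) (ψjm j) (φjm j) (φψj j) (ψφj j)
    obtain ⟨o1, o2⟩ := opA2 hu hmult c1
    obtain ⟨v1, v2⟩ := cov (φjd j) (φjm j) (ψjm j) (ψφj j) (φψj j) o1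
    have c3 : dirichletNorm (fun z => f ((psi lam a)^[j] z)) ≤ Real.sqrt 2 * S * d := by
      refine abs_le_of_sq_le_sq' (c2.trans ?_) (by positivity) |>.2
      rw [mul_pow, mul_pow, Real.sq_sqrt (by norm_num), hS, Real.sq_sqrt (by positivity)]
      have := psi_log hlam ha j
      have h2 : (j:ℝ) * ρ ≤ n * ρ := by gcongr
      gcongr
      linarith
    obtain ⟨r1, r2⟩ := L2D_of_le (C := W * V) (g := fun z => (wprod u φ n z * (u (φ^[j] z))⁻¹) *
        (deriv u (φ^[j] z) * deriv (φ^[j]) z) * f z) (by positivity) (by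
          refine ContinuousOn.mul (ContinuousOn.mul (hwd.continuousOn.mul
            ((hujd j).continuousOn.inv₀ fun z hz => hu0 _ (φjm j hz))) (ContinuousOn.mul ?_ ?_))
            hf.1.continuousOn
          · exact (deriv_diffOn hu).continuousOn.comp (φjd j).continuousOn (φjm j)
          · exact (deriv_diffOn (φjd j)).continuousOn) v1 (fun z hz => by
        rw [ψφj j z hz, mul_assoc, norm_mul, norm_mul]
        rw [show deriv u (φ^[j] z) * f z * deriv (φ^[j]) z =
          deriv u (φ^[j] z) * deriv (φ^[j]) z * f z by ring]
        gcongr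
        · exact hWle z hz
        · exact hVle _ (φjm j hz))
    refine ⟨r1, r2.trans ?_⟩
    rw [v2]
    gcongr
    exact o2.trans (by gcongr)
  obtain ⟨s1, s2⟩ := L2D_sum (Finset.range n) _ _ (fun j hj => (hterm j hj).1)
    (fun j hj => (hterm j hj).2)
  obtain ⟨t1, t2⟩ := L2D_of_le (g := fun z => wprod u φ n z * deriv f z) hW0
    (hwd.continuousOn.mul hf.L2D.1) hf.L2D (fun z hz => by
      rw [norm_mul]; gcongr; exact hWle z hz)
  have h0 : (0:ℂ) ∈ D1 := by simp [mem_D1]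
  have hder : a2 (deriv (mult (wprod u φ n) f)) ≤
      n * (W * V * (K * (Real.sqrt 2 * S * d))) + W * d := by
    have e : a2 (deriv (mult (wprod u φ n) f)) = _ :=
      a2_congr (h := fun z => (∑ j ∈ Finset.range n, (wprod u φ n z * (u (φ^[j] z))⁻¹) *
        (deriv u (φ^[j] z) * deriv (φ^[j]) z) * f z) + wprod u φ n z * deriv f z) (fun z hz => by
        rw [deriv_mult hwd hf.1 hz, hwderiv z hz, Finset.sum_mul])
    rw [e]
    refine (a2_add_le s1 t1).trans (add_le_add ?_ (t2.trans ?_))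
    · simpa using s2
    · gcongr; exact a2_le_dir f
  have hz0 : ‖mult (wprod u φ n) f 0‖ ≤ W * d := by
    rw [mult, norm_mul]
    gcongr
    · exact hWle 0 h0
    · exact zero_le_dir f
  have hfin := dir_le_add (mult (wprod u φ n) f)
  have hlast : 2 * (W * d) ≤ 2 * n * S * W * d := by
    have : 1 ≤ n * S := by nlinarith
    nlinarith [mul_nonneg hW0 hd0]
  calc _ ≤ W * d + (n * (W * V * (K * (Real.sqrt 2 * S * d))) + W * d) := by linarith
    _ ≤ n * (W * V * (K * (Real.sqrt 2 * S * d))) + 2 * n * S * W * d := by linarith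
    _ = _ := by ring
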